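/- Time-derivative estimate for bicaloric functions (Lemma 2.3, Euclidean case): For every integer n ≥ 1 and every ε ∈ (0,1) there is a constant c = c(n,ε) > 0 with the following property. Let p ∈ ℝⁿ, r > 0, and let u : ℝⁿ × ℝ → ℝ be smooth and satisfy ∂_t u + ΔΔu = 0 on ℝⁿ × [−r⁴, 0]. Then r⁸·∫_{Q_{εr}(p)} (∂_t u)² ≤ c·(∫_{Q_r(p)} u² + r²·∫_{Q_r(p)} |∇u|²). -/

import Mathlib

open Set Metric MeasureTheory

noncomputable section

/-- The Euclidean Laplacian of `f : ℝⁿ → ℝ`. -/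
def lapE (n : ℕ) (f : EuclideanSpace ℝ (Fin n) → ℝ) (x : EuclideanSpace ℝ (Fin n)) : ℝ :=
  ∑ i : Fin n, fderiv ℝ (fun y => fderiv ℝ f y (EuclideanSpace.single i 1)) x
    (EuclideanSpace.single i 1)

/-- The squared Hilbert–Schmidt norm of the Hessian of `f : ℝⁿ → ℝ`. -/
def hessNormSq (n : ℕ) (f : EuclideanSpace ℝ (Fin n) → ℝ) (x : EuclideanSpace ℝ (Fin n)) : ℝ :=
  ∑ i : Fin n, ∑ j : Fin n,
    (fderiv ℝ (fun y => fderiv ℝ f y (EuclideanSpace.single j 1)) x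
      (EuclideanSpace.single i 1)) ^ 2

/-- The spatial Laplacian of `u : ℝⁿ × ℝ → ℝ`. -/
def slap (n : ℕ) (u : EuclideanSpace ℝ (Fin n) × ℝ → ℝ) :
    EuclideanSpace ℝ (Fin n) × ℝ → ℝ :=
  fun z => lapE n (fun y => u (y, z.2)) z.1

/-- The time derivative of `u : ℝⁿ × ℝ → ℝ`. -/
def tderiv (n : ℕ) (u : EuclideanSpace ℝ (Fin n) × ℝ → ℝ) :
    EuclideanSpace ℝ (Fin n) × ℝ → ℝ :=
  fun z => deriv (fun s => u (z.1, s)) z.2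

/-- The spatial gradient of `u : ℝⁿ × ℝ → ℝ`. -/
def sgrad (n : ℕ) (u : EuclideanSpace ℝ (Fin n) × ℝ → ℝ) :
    EuclideanSpace ℝ (Fin n) × ℝ → EuclideanSpace ℝ (Fin n) :=
  fun z => gradient (fun y => u (y, z.2)) z.1

/-- The squared Hilbert–Schmidt norm of the spatial Hessian of `u : ℝⁿ × ℝ → ℝ`. -/
def shessNormSq (n : ℕ) (u : EuclideanSpace ℝ (Fin n) × ℝ → ℝ) :
    EuclideanSpace ℝ (Fin n) × ℝ → ℝ :=
  fun z => hessNormSq n (fun y => u (y, z.2)) z.1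

/-- The heat ball `Q_r(p) = B_r(p) × [-r⁴, 0]`. -/
def heatBall (n : ℕ) (p : EuclideanSpace ℝ (Fin n)) (r : ℝ) :
    Set (EuclideanSpace ℝ (Fin n) × ℝ) :=
  Metric.ball p r ×ˢ Set.Icc (-(r ^ 4)) 0

/-- `u` solves the biharmonic heat equation `∂ₜ u + ΔΔ u = 0` on `ℝⁿ × [-r⁴, 0]`. -/
def BicaloricOn (n : ℕ) (u : EuclideanSpace ℝ (Fin n) × ℝ → ℝ) (r : ℝ) : Prop :=
  ∀ (x : EuclideanSpace ℝ (Fin n)), ∀ t ∈ Set.Icc (-(r ^ 4)) (0 : ℝ),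
    tderiv n u (x, t) + slap n (slap n u) (x, t) = 0

/-- `u ∈ 𝒫_{d,d'}(ℝⁿ)`: a smooth ancient solution of the biharmonic heat equation with
`sup_{Q_R(p)} |u| ≤ C (1+R)^d` and `sup_{Q_R(p)} |∇u| ≤ C' (1+R)^{d'}`. -/
def PolyCaloric (n : ℕ) (d d' : ℝ) (u : EuclideanSpace ℝ (Fin n) × ℝ → ℝ) : Prop :=
  ContDiff ℝ (⊤ : ℕ∞) u ∧
  (∀ (x : EuclideanSpace ℝ (Fin n)), ∀ t ≤ (0 : ℝ),
    tderiv n u (x, t) + slap n (slap n u) (x, t) = 0) ∧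
  (∃ C : ℝ, 0 < C ∧ ∀ (p : EuclideanSpace ℝ (Fin n)) (R : ℝ), 0 < R →
    ∀ z ∈ heatBall n p R, |u z| ≤ C * (1 + R) ^ d) ∧
  (∃ C' : ℝ, 0 < C' ∧ ∀ (p : EuclideanSpace ℝ (Fin n)) (R : ℝ), 0 < R →
    ∀ z ∈ heatBall n p R, ‖sgrad n u z‖ ≤ C' * (1 + R) ^ d')

/-- `u ∈ ℋ_{d,d'}(ℝⁿ)`: a smooth biharmonic function with `sup_{B_R(p)} |u| ≤ C (1+R)^d`
and `sup_{B_R(p)} |∇u| ≤ C' (1+R)^{d'}`. -/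
def PolyBiharmonic (n : ℕ) (d d' : ℝ) (u : EuclideanSpace ℝ (Fin n) → ℝ) : Prop :=
  ContDiff ℝ (⊤ : ℕ∞) u ∧
  (∀ x, lapE n (lapE n u) x = 0) ∧
  (∃ C : ℝ, 0 < C ∧ ∀ (p : EuclideanSpace ℝ (Fin n)) (R : ℝ), 0 < R →
    ∀ x ∈ Metric.ball p R, |u x| ≤ C * (1 + R) ^ d) ∧
  (∃ C' : ℝ, 0 < C' ∧ ∀ (p : EuclideanSpace ℝ (Fin n)) (R : ℝ), 0 < R →
    ∀ x ∈ Metric.ball p R, ‖gradient u x‖ ≤ C' * (1 + R) ^ d')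

/-- The set `𝒫_{d,d'}(ℝⁿ)`. -/
def Pset (n : ℕ) (d d' : ℝ) : Set (EuclideanSpace ℝ (Fin n) × ℝ → ℝ) :=
  {u | PolyCaloric n d d' u}

/-- The set `ℋ_{d,d'}(ℝⁿ)`. -/
def Hset (n : ℕ) (d d' : ℝ) : Set (EuclideanSpace ℝ (Fin n) → ℝ) :=
  {u | PolyBiharmonic n d d' u}


/-! ### Spatial calculus -/

/-- The `i`-th partial derivative. -/
def pdE (n : ℕ) (i : Fin n) (f : EuclideanSpace ℝ (Fin n) → ℝ) (x : EuclideanSpace ℝ (Fin n)) : ℝ :=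
  fderiv ℝ f x (EuclideanSpace.single i 1)

lemma lapE_eq (n : ℕ) (f : EuclideanSpace ℝ (Fin n) → ℝ) (x : EuclideanSpace ℝ (Fin n)) :
    lapE n f x = ∑ i, pdE n i (pdE n i f) x := rfl

lemma pdE_smooth {n : ℕ} (i : Fin n) {f : EuclideanSpace ℝ (Fin n) → ℝ}
    (hf : ContDiff ℝ (⊤ : ℕ∞) f) : ContDiff ℝ (⊤ : ℕ∞) (pdE n i f) := by
  have h : ContDiff ℝ (⊤ : ℕ∞) (fderiv ℝ f) := hf.fderiv_right (by simp)
  exact h.clm_apply contDiff_const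

lemma lapE_smooth {n : ℕ} {f : EuclideanSpace ℝ (Fin n) → ℝ}
    (hf : ContDiff ℝ (⊤ : ℕ∞) f) : ContDiff ℝ (⊤ : ℕ∞) (lapE n f) := by
  have : lapE n f = fun x => ∑ i, pdE n i (pdE n i f) x := rfl
  rw [this]
  exact ContDiff.sum fun i _ => pdE_smooth i (pdE_smooth i hf)

lemma smooth_diff {n : ℕ} {f : EuclideanSpace ℝ (Fin n) → ℝ}
    (hf : ContDiff ℝ (⊤ : ℕ∞) f) (x : EuclideanSpace ℝ (Fin n)) : DifferentiableAt ℝ f x :=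
  hf.differentiable (by simp) x

lemma pdE_mul {n : ℕ} (i : Fin n) {f g : EuclideanSpace ℝ (Fin n) → ℝ}
    (hf : ContDiff ℝ (⊤ : ℕ∞) f) (hg : ContDiff ℝ (⊤ : ℕ∞) g) :
    pdE n i (fun x => f x * g x) = fun x => pdE n i f x * g x + f x * pdE n i g x := by
  funext x
  unfold pdE
  rw [fderiv_fun_mul (smooth_diff hf x) (smooth_diff hg x)]
  simp
  ring

lemma pdE_add {n : ℕ} (i : Fin n) {f g : EuclideanSpace ℝ (Fin n) → ℝ}
    (hf : ContDiff ℝ (⊤ : ℕ∞) f) (hg : ContDiff ℝ (⊤ : ℕ∞) g) :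
    pdE n i (fun x => f x + g x) = fun x => pdE n i f x + pdE n i g x := by
  funext x
  unfold pdE
  rw [fderiv_fun_add (smooth_diff hf x) (smooth_diff hg x)]
  simp

lemma lapE_mul {n : ℕ} {f g : EuclideanSpace ℝ (Fin n) → ℝ}
    (hf : ContDiff ℝ (⊤ : ℕ∞) f) (hg : ContDiff ℝ (⊤ : ℕ∞) g) (x : EuclideanSpace ℝ (Fin n)) :
    lapE n (fun x => f x * g x) x
      = lapE n f x * g x + 2 * (∑ i, pdE n i f x * pdE n i g x) + f x * lapE n g x := by
  simp only [lapE_eq]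
  rw [Finset.sum_mul, Finset.mul_sum, Finset.mul_sum, ← Finset.sum_add_distrib,
    ← Finset.sum_add_distrib]
  refine Finset.sum_congr rfl fun i _ => ?_
  have hfi := pdE_smooth i hf
  have hgi := pdE_smooth i hg
  rw [pdE_mul i hf hg, pdE_add i (hfi.mul hg) (hf.mul hgi), pdE_mul i hfi hg, pdE_mul i hf hgi]
  simp only []
  ring

/-- squares -/
lemma pdE_sq {n : ℕ} (i : Fin n) {f : EuclideanSpace ℝ (Fin n) → ℝ}
    (hf : ContDiff ℝ (⊤ : ℕ∞) f) (x : EuclideanSpace ℝ (Fin n)) :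
    pdE n i (fun x => f x ^ 2) x = 2 * f x * pdE n i f x := by
  have : (fun x => f x ^ 2) = fun x => f x * f x := by funext x; ring
  rw [this, pdE_mul i hf hf]
  ring

lemma lapE_sq {n : ℕ} {f : EuclideanSpace ℝ (Fin n) → ℝ}
    (hf : ContDiff ℝ (⊤ : ℕ∞) f) (x : EuclideanSpace ℝ (Fin n)) :
    lapE n (fun x => f x ^ 2) x
      = 2 * (∑ i, pdE n i f x ^ 2) + 2 * f x * lapE n f x := by
  have : (fun x => f x ^ 2) = fun x => f x * f x := by funext x; ring
  rw [this, lapE_mul hf hf]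
  simp only [← sq]
  ring

lemma pdE_pow4 {n : ℕ} (i : Fin n) {f : EuclideanSpace ℝ (Fin n) → ℝ}
    (hf : ContDiff ℝ (⊤ : ℕ∞) f) (x : EuclideanSpace ℝ (Fin n)) :
    pdE n i (fun x => f x ^ 4) x = 4 * f x ^ 3 * pdE n i f x := by
  have : (fun x => f x ^ 4) = fun x => (f x ^ 2) ^ 2 := by funext x; ring
  rw [this, pdE_sq i (hf.pow 2), pdE_sq i hf]
  ring

lemma lapE_pow4 {n : ℕ} {f : EuclideanSpace ℝ (Fin n) → ℝ}
    (hf : ContDiff ℝ (⊤ : ℕ∞) f) (x : EuclideanSpace ℝ (Fin n)) :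
    lapE n (fun x => f x ^ 4) x
      = 12 * f x ^ 2 * (∑ i, pdE n i f x ^ 2) + 4 * f x ^ 3 * lapE n f x := by
  have : (fun x => f x ^ 4) = fun x => (f x ^ 2) ^ 2 := by funext x; ring
  rw [this, lapE_sq (hf.pow 2), lapE_sq hf]
  simp only [pdE_sq _ hf, mul_pow, ← Finset.mul_sum]
  ring

lemma lapE_pow4_mul {n : ℕ} {η f : EuclideanSpace ℝ (Fin n) → ℝ}
    (hη : ContDiff ℝ (⊤ : ℕ∞) η) (hf : ContDiff ℝ (⊤ : ℕ∞) f) (x : EuclideanSpace ℝ (Fin n)) :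
    lapE n (fun x => η x ^ 4 * f x) x
      = η x ^ 4 * lapE n f x + 8 * η x ^ 3 * (∑ i, pdE n i η x * pdE n i f x)
        + f x * (12 * η x ^ 2 * (∑ i, pdE n i η x ^ 2) + 4 * η x ^ 3 * lapE n η x) := by
  rw [lapE_mul (hη.pow 4) hf, lapE_pow4 hη]
  simp only [pdE_pow4 _ hη]
  have : ∑ i, 4 * η x ^ 3 * pdE n i η x * pdE n i f x
      = 4 * η x ^ 3 * ∑ i, pdE n i η x * pdE n i f x := by
    rw [Finset.mul_sum]; exact Finset.sum_congr rfl fun i _ => by ring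
  rw [this]; ring

lemma pdE_compact {n : ℕ} (i : Fin n) {f : EuclideanSpace ℝ (Fin n) → ℝ}
    (hf : HasCompactSupport f) : HasCompactSupport (pdE n i f) := by
  exact hf.fderiv_apply ℝ _

lemma ibp_pdE {n : ℕ} (i : Fin n) {f g : EuclideanSpace ℝ (Fin n) → ℝ}
    (hf : ContDiff ℝ (⊤ : ℕ∞) f) (hg : ContDiff ℝ (⊤ : ℕ∞) g) (hc : HasCompactSupport f) :
    ∫ x, f x * pdE n i g x = - ∫ x, pdE n i f x * g x := by
  apply integral_mul_fderiv_eq_neg_fderiv_mul_of_integrable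
  · exact ((pdE_smooth i hf).continuous.mul hg.continuous).integrable_of_hasCompactSupport
      ((pdE_compact i hc).mul_right)
  · exact (hf.continuous.mul (pdE_smooth i hg).continuous).integrable_of_hasCompactSupport
      (hc.mul_right)
  · exact (hf.continuous.mul hg.continuous).integrable_of_hasCompactSupport (hc.mul_right)
  · exact fun x _ => smooth_diff hf x
  · exact fun x _ => smooth_diff hg x

lemma green_lapE {n : ℕ} {f g : EuclideanSpace ℝ (Fin n) → ℝ}
    (hf : ContDiff ℝ (⊤ : ℕ∞) f) (hg : ContDiff ℝ (⊤ : ℕ∞) g) (hc : HasCompactSupport f) :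
    ∫ x, f x * lapE n g x = ∫ x, lapE n f x * g x := by
  simp only [lapE_eq, Finset.mul_sum, Finset.sum_mul]
  rw [integral_finsetSum, integral_finsetSum]
  · refine Finset.sum_congr rfl fun i _ => ?_
    rw [ibp_pdE i hf (pdE_smooth i hg) hc, ibp_pdE i (pdE_smooth i hf) hg (pdE_compact i hc)]
    simp
  · intro i _
    exact ((pdE_smooth i (pdE_smooth i hf)).continuous.mul
      hg.continuous).integrable_of_hasCompactSupport
      ((pdE_compact i (pdE_compact i hc)).mul_right)
  · intro i _
    exact (hf.continuous.mul
      (pdE_smooth i (pdE_smooth i hg)).continuous).integrable_of_hasCompactSupport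
      (hc.mul_right)

lemma ball_integrable {n : ℕ} (p : EuclideanSpace ℝ (Fin n)) (r : ℝ)
    {f : EuclideanSpace ℝ (Fin n) → ℝ} (hf : Continuous f) : IntegrableOn f (ball p r) :=
  (hf.continuousOn.integrableOn_compact (isCompact_closedBall p r)).mono_set ball_subset_closedBall

lemma cs_sum {n : ℕ} (a b : Fin n → ℝ) {L : ℝ} (h : ∑ i, a i ^ 2 ≤ L ^ 2) :
    (∑ i, a i * b i) ^ 2 ≤ L ^ 2 * ∑ i, b i ^ 2 :=
  (Finset.sum_mul_sq_le_sq_mul_sq _ _ _).trans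
    (mul_le_mul_of_nonneg_right h (Finset.sum_nonneg fun i _ => sq_nonneg _))

lemma coef_bound {e N M L : ℝ} (h0 : 0 ≤ e) (h1 : e ≤ 1) (hN0 : 0 ≤ N) (hN : N ≤ L ^ 2)
    (hM : |M| ≤ L ^ 2) : (12 * N + 4 * e * M) ^ 2 ≤ 256 * L ^ 4 := by
  have h := abs_le.1 hM
  have : |12 * N + 4 * e * M| ≤ 16 * L ^ 2 := by
    rw [abs_le]; constructor <;> nlinarith [mul_nonneg h0 (sq_nonneg L), sq_nonneg L]
  calc _ = |12 * N + 4 * e * M| ^ 2 := (sq_abs _).symm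
    _ ≤ (16 * L ^ 2) ^ 2 := by gcongr
    _ = _ := by ring

lemma pointwise1 {e S N M L F f w : ℝ} (h0 : 0 ≤ e) (h1 : e ≤ 1) (hN0 : 0 ≤ N) (hN : N ≤ L ^ 2)
    (hM : |M| ≤ L ^ 2) (hS : S ^ 2 ≤ L ^ 2 * F) (hF : 0 ≤ F) :
    -((e ^ 4 * w + 8 * e ^ 3 * S + f * (12 * e ^ 2 * N + 4 * e ^ 3 * M)) * w)
      ≤ -(1 / 2) * (e ^ 4 * w ^ 2) + 256 * (L ^ 2 * F + L ^ 4 * f ^ 2) := by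
  have hc := mul_le_mul_of_nonneg_right (coef_bound h0 h1 hN0 hN hM) (sq_nonneg f)
  have a1 := sq_nonneg (e ^ 2 * w / 2 + 8 * e * S)
  have a2 := sq_nonneg (e ^ 2 * w / 2 + f * (12 * N + 4 * e * M))
  have e2 : e ^ 2 ≤ 1 := by nlinarith
  have a3 : e ^ 2 * S ^ 2 ≤ L ^ 2 * F := by nlinarith [sq_nonneg S]
  have : 0 ≤ L ^ 2 * F := by positivity
  nlinarith

lemma pointwise2 {e S N M L F w g : ℝ} (h0 : 0 ≤ e) (h1 : e ≤ 1) (hN0 : 0 ≤ N) (hN : N ≤ L ^ 2)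
    (hM : |M| ≤ L ^ 2) (hS : S ^ 2 ≤ L ^ 2 * F) :
    (e ^ 4 * (-g) + 8 * e ^ 3 * S + w * (12 * e ^ 2 * N + 4 * e ^ 3 * M)) * g
      - 128 * L ^ 2 * (e ^ 2 * F - e ^ 2 * g * w + 2 * e * S * w)
      ≤ -(1 / 4) * (e ^ 4 * g ^ 2) + 17000 * (L ^ 4 * w ^ 2) := by
  have hc := mul_le_mul_of_nonneg_right (coef_bound h0 h1 hN0 hN hM) (sq_nonneg w)
  have a1 := sq_nonneg (e ^ 2 * g / 2 - 8 * e * S)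
  have a2 := sq_nonneg (e ^ 2 * g / 2 - w * (12 * N + 4 * e * M))
  have a3 := mul_le_mul_of_nonneg_left hS (sq_nonneg e)
  have a4 := sq_nonneg (e ^ 2 * g / 2 - 128 * L ^ 2 * w)
  have a5 := sq_nonneg (8 * e * S + 16 * L ^ 2 * w)
  have a6 : 0 ≤ L ^ 4 * w ^ 2 := by positivity
  nlinarith

/-- Spatial cutoff data. -/
structure Cutoff (n : ℕ) (p : EuclideanSpace ℝ (Fin n)) (r θ L : ℝ)
    (η : EuclideanSpace ℝ (Fin n) → ℝ) : Prop where
  smooth : ContDiff ℝ (⊤ : ℕ∞) η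
  compact : HasCompactSupport η
  nonneg : ∀ x, 0 ≤ η x
  le_one : ∀ x, η x ≤ 1
  zero : ∀ x, x ∉ ball p r → η x = 0
  one : ∀ x ∈ ball p (θ * r), η x = 1
  grad : ∀ x, ∑ i, pdE n i η x ^ 2 ≤ L ^ 2
  lap : ∀ x, |lapE n η x| ≤ L ^ 2

lemma pow4_mul_compact {n : ℕ} {η f : EuclideanSpace ℝ (Fin n) → ℝ}
    (h : HasCompactSupport η) : HasCompactSupport (fun x => η x ^ 4 * f x) := by
  have : HasCompactSupport (fun x => η x * (η x ^ 3 * f x)) := h.mul_right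
  convert this using 2
  ring

/-- First slice estimate. -/
lemma slice1 {n : ℕ} {p : EuclideanSpace ℝ (Fin n)} {r θ L : ℝ}
    {η f : EuclideanSpace ℝ (Fin n) → ℝ} (H : Cutoff n p r θ L η) (hf : ContDiff ℝ (⊤ : ℕ∞) f) :
    ∫ x in ball p r, η x ^ 4 * (f x * -lapE n (lapE n f) x) ≤
      ∫ x in ball p r, (-(1 / 2) * (η x ^ 4 * lapE n f x ^ 2)
        + 256 * (L ^ 2 * (∑ i, pdE n i f x ^ 2) + L ^ 4 * f x ^ 2)) := by
  have hw := lapE_smooth hf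
  have hη := H.smooth
  have hφ : ContDiff ℝ (⊤ : ℕ∞) (fun x => η x ^ 4 * f x) := (hη.pow 4).mul hf
  have key := green_lapE hφ hw (pow4_mul_compact H.compact)
  have e1 : ∫ x in ball p r, η x ^ 4 * (f x * -lapE n (lapE n f) x)
      = - ∫ x, η x ^ 4 * f x * lapE n (lapE n f) x := by
    rw [setIntegral_eq_integral_of_forall_compl_eq_zero, ← integral_neg]
    · congr 1; funext x; ring
    · intro x hx; rw [H.zero x hx]; ring
  have e2 : - ∫ x, lapE n (fun x => η x ^ 4 * f x) x * lapE n f x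
      = ∫ x in ball p r, -(lapE n (fun x => η x ^ 4 * f x) x * lapE n f x) := by
    rw [setIntegral_eq_integral_of_forall_compl_eq_zero, ← integral_neg]
    intro x hx; rw [lapE_pow4_mul hη hf, H.zero x hx]; ring
  rw [e1, key, e2]
  refine setIntegral_mono_on (ball_integrable _ _ ?_) (ball_integrable _ _ ?_)
    measurableSet_ball ?_
  · exact ((lapE_smooth hφ).continuous.mul hw.continuous).neg
  · have h1 := hw.continuous
    have h2 := hη.continuous
    have h3 := hf.continuous
    have h4 : ∀ i, Continuous (pdE n i f) := fun i => (pdE_smooth i hf).continuous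
    fun_prop
  · intro x _
    rw [lapE_pow4_mul hη hf]
    exact pointwise1 (H.nonneg x) (H.le_one x) (Finset.sum_nonneg fun i _ => sq_nonneg _)
      (H.grad x) (H.lap x) (cs_sum _ _ (H.grad x)) (Finset.sum_nonneg fun i _ => sq_nonneg _)

lemma energy_id {n : ℕ} {η w : EuclideanSpace ℝ (Fin n) → ℝ} (hη : ContDiff ℝ (⊤ : ℕ∞) η)
    (hc : HasCompactSupport η) (hw : ContDiff ℝ (⊤ : ℕ∞) w) :
    ∫ x, (η x ^ 2 * (∑ i, pdE n i w x ^ 2) + η x ^ 2 * lapE n w x * w x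
      + 2 * η x * (∑ i, pdE n i η x * pdE n i w x) * w x) = 0 := by
  have hi : ∀ i, ContDiff ℝ (⊤ : ℕ∞) (pdE n i w) := fun i => pdE_smooth i hw
  have hcc : ∀ i, HasCompactSupport (fun x => η x ^ 2 * pdE n i w x) := by
    intro i
    have : HasCompactSupport (fun x => η x * (η x * pdE n i w x)) := hc.mul_right
    convert this using 2
    ring
  have hs : ∀ i, ContDiff ℝ (⊤ : ℕ∞) (fun x => η x ^ 2 * pdE n i w x) :=
    fun i => (hη.pow 2).mul (hi i)
  have key : ∀ i, ∫ x, (η x ^ 2 * pdE n i w x * pdE n i w x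
      + pdE n i (fun x => η x ^ 2 * pdE n i w x) x * w x) = 0 := by
    intro i
    rw [integral_add, ibp_pdE i (hs i) hw (hcc i)]
    · simp
    · exact ((hs i).continuous.mul (hi i).continuous).integrable_of_hasCompactSupport
        (hcc i).mul_right
    · exact ((pdE_smooth i (hs i)).continuous.mul hw.continuous).integrable_of_hasCompactSupport
        (pdE_compact i (hcc i)).mul_right
  have := Finset.sum_eq_zero (s := Finset.univ) fun i _ => key i
  rw [← integral_finsetSum] at this
  · rw [← this]
    congr 1; funext x
    rw [lapE_eq, Finset.mul_sum, Finset.mul_sum, Finset.mul_sum, Finset.sum_mul, Finset.sum_mul,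
      ← Finset.sum_add_distrib, ← Finset.sum_add_distrib]
    refine Finset.sum_congr rfl fun i _ => ?_
    rw [pdE_mul i (hη.pow 2) (hi i)]
    simp only [pdE_sq i hη]
    ring
  · intro i _
    refine Integrable.add ?_ ?_
    · exact ((hs i).continuous.mul (hi i).continuous).integrable_of_hasCompactSupport
        (hcc i).mul_right
    · exact ((pdE_smooth i (hs i)).continuous.mul hw.continuous).integrable_of_hasCompactSupport
        (pdE_compact i (hcc i)).mul_right

/-- Second slice estimate. -/
lemma slice2 {n : ℕ} {p : EuclideanSpace ℝ (Fin n)} {r θ L : ℝ}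
    {η w g : EuclideanSpace ℝ (Fin n) → ℝ} (H : Cutoff n p r θ L η) (hw : ContDiff ℝ (⊤ : ℕ∞) w)
    (hg : ContDiff ℝ (⊤ : ℕ∞) g) (hgw : ∀ x, g x + lapE n w x = 0) :
    ∫ x in ball p r, η x ^ 4 * (w x * lapE n g x) ≤
      ∫ x in ball p r, (-(1 / 4) * (η x ^ 4 * g x ^ 2) + 17000 * (L ^ 4 * w x ^ 2)) := by
  have hη := H.smooth
  have hφ : ContDiff ℝ (⊤ : ℕ∞) (fun x => η x ^ 4 * w x) := (hη.pow 4).mul hw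
  have key := green_lapE hφ hg (pow4_mul_compact H.compact)
  have hlw : ∀ x, lapE n w x = - g x := fun x => by linarith [hgw x]
  have h1 := hw.continuous
  have h2 := hη.continuous
  have h3 := hg.continuous
  have h4 : ∀ i, Continuous (pdE n i w) := fun i => (pdE_smooth i hw).continuous
  have h5 : ∀ i, Continuous (pdE n i η) := fun i => (pdE_smooth i hη).continuous
  have h6 := (lapE_smooth hφ).continuous
  have en : ∫ x in ball p r, (η x ^ 2 * (∑ i, pdE n i w x ^ 2) - η x ^ 2 * g x * w x
      + 2 * η x * (∑ i, pdE n i η x * pdE n i w x) * w x) = 0 := by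
    rw [setIntegral_eq_integral_of_forall_compl_eq_zero, ← energy_id hη H.compact hw]
    · congr 1; funext x; rw [hlw]; ring
    · intro x hx; rw [H.zero x hx]; ring
  have e1 : ∫ x in ball p r, η x ^ 4 * (w x * lapE n g x)
      = ∫ x, η x ^ 4 * w x * lapE n g x := by
    rw [setIntegral_eq_integral_of_forall_compl_eq_zero]
    · congr 1; funext x; ring
    · intro x hx; rw [H.zero x hx]; ring
  have e2 : ∫ x, lapE n (fun x => η x ^ 4 * w x) x * g x
      = ∫ x in ball p r, (lapE n (fun x => η x ^ 4 * w x) x * g x) := by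
    rw [setIntegral_eq_integral_of_forall_compl_eq_zero]
    intro x hx; rw [lapE_pow4_mul hη hw, H.zero x hx]; ring
  have e3 : ∫ x in ball p r, (lapE n (fun x => η x ^ 4 * w x) x * g x)
     = ∫ x in ball p r, (lapE n (fun x => η x ^ 4 * w x) x * g x - 128 * L ^ 2 *
       (η x ^ 2 * (∑ i, pdE n i w x ^ 2) - η x ^ 2 * g x * w x
      + 2 * η x * (∑ i, pdE n i η x * pdE n i w x) * w x)) := by
    rw [integral_sub, integral_const_mul, en]
    · simp
    · exact ball_integrable _ _ (by fun_prop)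
    · exact ball_integrable _ _ (by fun_prop)
  rw [e1, key, e2, e3]
  refine setIntegral_mono_on (ball_integrable _ _ (by fun_prop))
    (ball_integrable _ _ (by fun_prop)) measurableSet_ball ?_
  intro x _
  rw [lapE_pow4_mul hη hw, hlw]
  exact pointwise2 (H.nonneg x) (H.le_one x) (Finset.sum_nonneg fun i _ => sq_nonneg _)
      (H.grad x) (H.lap x) (cs_sum _ _ (H.grad x))

/-! ### Space-time calculus -/

/-- Spatial partial derivative of a space-time function. -/
def spd (n : ℕ) (i : Fin n) (u : EuclideanSpace ℝ (Fin n) × ℝ → ℝ)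
    (z : EuclideanSpace ℝ (Fin n) × ℝ) : ℝ :=
  fderiv ℝ u z (EuclideanSpace.single i 1, 0)

lemma dir_smooth {n : ℕ} (v : EuclideanSpace ℝ (Fin n) × ℝ)
    {u : EuclideanSpace ℝ (Fin n) × ℝ → ℝ}
    (hu : ContDiff ℝ (⊤ : ℕ∞) u) : ContDiff ℝ (⊤ : ℕ∞) (fun z => fderiv ℝ u z v) := by
  have h : ContDiff ℝ (⊤ : ℕ∞) (fderiv ℝ u) := hu.fderiv_right (by simp)
  exact h.clm_apply contDiff_const

lemma spd_smooth {n : ℕ} (i : Fin n) {u : EuclideanSpace ℝ (Fin n) × ℝ → ℝ}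
    (hu : ContDiff ℝ (⊤ : ℕ∞) u) : ContDiff ℝ (⊤ : ℕ∞) (spd n i u) := dir_smooth _ hu

lemma slice_smooth {n : ℕ} {u : EuclideanSpace ℝ (Fin n) × ℝ → ℝ}
    (hu : ContDiff ℝ (⊤ : ℕ∞) u) (t : ℝ) : ContDiff ℝ (⊤ : ℕ∞) (fun y => u (y, t)) :=
  hu.comp (contDiff_id.prodMk contDiff_const)

lemma pdE_slice {n : ℕ} (i : Fin n) {u : EuclideanSpace ℝ (Fin n) × ℝ → ℝ}
    (hu : ContDiff ℝ (⊤ : ℕ∞) u) (t : ℝ) :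
    pdE n i (fun y => u (y, t)) = fun x => spd n i u (x, t) := by
  funext x
  have h1 : HasFDerivAt u (fderiv ℝ u (x, t)) (x, t) :=
    (hu.differentiable (by simp) (x, t)).hasFDerivAt
  have h2 : HasFDerivAt (fun y : EuclideanSpace ℝ (Fin n) => (y, t))
      (ContinuousLinearMap.inl ℝ _ ℝ) x := hasFDerivAt_prodMk_left x t
  have h3 := (h1.comp x h2).fderiv
  unfold pdE spd
  change fderiv ℝ (u ∘ fun y => (y, t)) x _ = _
  rw [h3]
  simp

lemma tderiv_eq {n : ℕ} {u : EuclideanSpace ℝ (Fin n) × ℝ → ℝ}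
    (hu : ContDiff ℝ (⊤ : ℕ∞) u) : tderiv n u = fun z => fderiv ℝ u z (0, 1) := by
  funext z
  obtain ⟨x, t⟩ := z
  have h1 : HasFDerivAt u (fderiv ℝ u (x, t)) (x, t) :=
    (hu.differentiable (by simp) (x, t)).hasFDerivAt
  have h2 : HasDerivAt (fun s : ℝ => (x, s)) ((0 : EuclideanSpace ℝ (Fin n)), (1 : ℝ)) t :=
    (hasDerivAt_const t x).prodMk (hasDerivAt_id t)
  exact (h1.comp_hasDerivAt t h2).deriv

lemma tderiv_smooth {n : ℕ} {u : EuclideanSpace ℝ (Fin n) × ℝ → ℝ}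
    (hu : ContDiff ℝ (⊤ : ℕ∞) u) : ContDiff ℝ (⊤ : ℕ∞) (tderiv n u) := by
  rw [tderiv_eq hu]; exact dir_smooth _ hu

lemma tderiv_hasDerivAt {n : ℕ} {u : EuclideanSpace ℝ (Fin n) × ℝ → ℝ}
    (hu : ContDiff ℝ (⊤ : ℕ∞) u) (x : EuclideanSpace ℝ (Fin n)) (t : ℝ) :
    HasDerivAt (fun s => u (x, s)) (tderiv n u (x, t)) t := by
  have : ContDiff ℝ (⊤ : ℕ∞) (fun s => u (x, s)) := hu.comp (contDiff_const.prodMk contDiff_id)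
  exact (this.differentiable (by simp) t).hasDerivAt

lemma slap_eq {n : ℕ} {u : EuclideanSpace ℝ (Fin n) × ℝ → ℝ}
    (hu : ContDiff ℝ (⊤ : ℕ∞) u) : slap n u = fun z => ∑ i, spd n i (spd n i u) z := by
  funext z
  unfold slap
  rw [lapE_eq]
  refine Finset.sum_congr rfl fun i _ => ?_
  rw [pdE_slice i hu, pdE_slice i (spd_smooth i hu)]

lemma slap_smooth {n : ℕ} {u : EuclideanSpace ℝ (Fin n) × ℝ → ℝ}
    (hu : ContDiff ℝ (⊤ : ℕ∞) u) : ContDiff ℝ (⊤ : ℕ∞) (slap n u) := by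
  rw [slap_eq hu]
  exact ContDiff.sum fun i _ => spd_smooth i (spd_smooth i hu)

lemma dir_comm {n : ℕ} (v w : EuclideanSpace ℝ (Fin n) × ℝ)
    {u : EuclideanSpace ℝ (Fin n) × ℝ → ℝ}
    (hu : ContDiff ℝ (⊤ : ℕ∞) u) (z : EuclideanSpace ℝ (Fin n) × ℝ) :
    fderiv ℝ (fun z => fderiv ℝ u z v) z w = fderiv ℝ (fun z => fderiv ℝ u z w) z v := by
  have h : ContDiff ℝ (⊤ : ℕ∞) (fderiv ℝ u) := hu.fderiv_right (by simp)
  have hd := h.differentiable (by simp) z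
  have hs : IsSymmSndFDerivAt ℝ u z := hu.contDiffAt.isSymmSndFDerivAt (by
    simp only [minSmoothness_of_isRCLikeNormedField]
    exact WithTop.coe_le_coe.2 (le_top : (2 : ℕ∞) ≤ ⊤))
  rw [fderiv_clm_apply hd (by fun_prop), fderiv_clm_apply hd (by fun_prop)]
  simpa using hs w v

lemma tderiv_spd {n : ℕ} (i : Fin n) {u : EuclideanSpace ℝ (Fin n) × ℝ → ℝ}
    (hu : ContDiff ℝ (⊤ : ℕ∞) u) : tderiv n (spd n i u) = spd n i (tderiv n u) := by
  rw [tderiv_eq (spd_smooth i hu), tderiv_eq hu]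
  funext z
  exact dir_comm _ _ hu z

lemma tderiv_slap {n : ℕ} {u : EuclideanSpace ℝ (Fin n) × ℝ → ℝ}
    (hu : ContDiff ℝ (⊤ : ℕ∞) u) : tderiv n (slap n u) = slap n (tderiv n u) := by
  rw [slap_eq hu, slap_eq (tderiv_smooth hu)]
  funext z
  have h : ∀ i, DifferentiableAt ℝ (spd n i (spd n i u)) z := fun i =>
    (spd_smooth i (spd_smooth i hu)).differentiable (by simp) z
  have hs : ContDiff ℝ (⊤ : ℕ∞) (fun z => ∑ i, spd n i (spd n i u) z) :=
    ContDiff.sum fun i _ => spd_smooth i (spd_smooth i hu)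
  rw [tderiv_eq hs]
  simp only []
  rw [fderiv_fun_sum fun i _ => h i]
  simp only [_root_.sum_apply]
  refine Finset.sum_congr rfl fun i _ => ?_
  rw [← tderiv_spd i hu, ← tderiv_spd i (spd_smooth i hu), tderiv_eq (spd_smooth i (spd_smooth i hu))]

lemma sgrad_norm_sq {n : ℕ} (u : EuclideanSpace ℝ (Fin n) × ℝ → ℝ)
    (z : EuclideanSpace ℝ (Fin n) × ℝ) :
    ‖sgrad n u z‖ ^ 2 = ∑ i, pdE n i (fun y => u (y, z.2)) z.1 ^ 2 := by
  rw [EuclideanSpace.real_norm_sq_eq]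
  refine Finset.sum_congr rfl fun i _ => ?_
  congr 1
  unfold sgrad pdE
  rw [← inner_gradient_left, EuclideanSpace.inner_single_right]
  simp

/-! ### Time integration -/

lemma heatBall_integrable {n : ℕ} (p : EuclideanSpace ℝ (Fin n)) (r : ℝ)
    {f : EuclideanSpace ℝ (Fin n) × ℝ → ℝ} (hf : Continuous f) :
    IntegrableOn f (heatBall n p r) :=
  (hf.continuousOn.integrableOn_compact
    ((isCompact_closedBall p r).prod (isCompact_Icc (a := -(r ^ 4)) (b := 0)))).mono_set
    (prod_mono ball_subset_closedBall subset_rfl)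

lemma heatBall_fubini {n : ℕ} (p : EuclideanSpace ℝ (Fin n)) (r : ℝ)
    {f : EuclideanSpace ℝ (Fin n) × ℝ → ℝ} (hf : Continuous f) :
    ∫ z in heatBall n p r, f z = ∫ x in ball p r, ∫ t in Icc (-(r ^ 4)) 0, f (x, t) := by
  have := heatBall_integrable p r hf
  unfold heatBall at this ⊢
  rw [Measure.volume_eq_prod] at this ⊢
  exact setIntegral_prod f this

lemma heatBall_fubini_symm {n : ℕ} (p : EuclideanSpace ℝ (Fin n)) (r : ℝ)
    {f : EuclideanSpace ℝ (Fin n) × ℝ → ℝ} (hf : Continuous f) :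
    IntegrableOn (fun t => ∫ x in ball p r, f (x, t)) (Icc (-(r ^ 4)) 0) ∧
    ∫ z in heatBall n p r, f z = ∫ t in Icc (-(r ^ 4)) 0, ∫ x in ball p r, f (x, t) := by
  have := heatBall_integrable p r hf
  unfold heatBall at this ⊢
  rw [Measure.volume_eq_prod] at this ⊢
  rw [IntegrableOn, ← Measure.prod_restrict] at this
  rw [← Measure.prod_restrict]
  exact ⟨this.integral_prod_right, integral_prod_symm f this⟩

lemma time_nonneg {b : ℝ} (hb : 0 < b) {a a' : ℝ → ℝ} (ha : ∀ t, HasDerivAt a (a' t) t)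
    (hc : Continuous a') :
    0 ≤ ∫ t in Icc (-b) 0, (2 * ((t + b) / b) * (a t * a' t) + a t ^ 2 / b) := by
  have hca : Continuous a := continuous_iff_continuousAt.2 fun t => (ha t).continuousAt
  rw [integral_Icc_eq_integral_Ioc, ← intervalIntegral.integral_of_le (by linarith)]
  have hd : ∀ t ∈ uIcc (-b) 0, HasDerivAt (fun t => (t + b) / b * a t ^ 2)
      (2 * ((t + b) / b) * (a t * a' t) + a t ^ 2 / b) t := by
    intro t _
    have h1 : HasDerivAt (fun t => (t + b) / b) (1 / b) t :=
      ((hasDerivAt_id t).add_const b).div_const b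
    have h2 := h1.mul ((ha t).pow 2)
    refine h2.congr_deriv ?_
    simp
    ring
  rw [intervalIntegral.integral_eq_sub_of_hasDerivAt hd
    (Continuous.intervalIntegrable (by fun_prop) _ _)]
  have : (0 + b) / b = 1 := by rw [zero_add, div_self hb.ne']
  simp only [this]
  simp
  positivity

lemma energy {n : ℕ} {p : EuclideanSpace ℝ (Fin n)} {r θ L κ : ℝ} (hr : 0 < r)
    (hθ : θ ∈ Ioo (0 : ℝ) 1) (hκ : 0 < κ)
    {η : EuclideanSpace ℝ (Fin n) → ℝ} (C : Cutoff n p r θ L η)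
    {U G H : EuclideanSpace ℝ (Fin n) × ℝ → ℝ} (hU : ContDiff ℝ (⊤ : ℕ∞) U)
    (hG : Continuous G) (hH : Continuous H) (hG0 : ∀ z, 0 ≤ G z) (hH0 : ∀ z, 0 ≤ H z)
    (hyp : ∀ t ∈ Icc (-(r ^ 4)) 0, ∫ x in ball p r, η x ^ 4 * (U (x, t) * tderiv n U (x, t)) ≤
      ∫ x in ball p r, (-κ * (η x ^ 4 * G (x, t)) + H (x, t))) :
    (1 - θ ^ 4) * (2 * κ) * ∫ z in heatBall n p (θ * r), G z ≤
      ∫ z in heatBall n p r, (2 * H z + U z ^ 2 / r ^ 4) := by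
  have hη := C.smooth.continuous
  have hUc := hU.continuous
  have hTc := (tderiv_smooth hU).continuous
  have hb : 0 < r ^ 4 := by positivity
  have hθ4 : θ ^ 4 < 1 := pow_lt_one₀ hθ.1.le hθ.2 (by norm_num)
  have mQ : ∀ s, MeasurableSet (heatBall n p s) := fun s =>
    measurableSet_ball.prod measurableSet_Icc
  have ha : 0 ≤ ∫ z in heatBall n p r, η z.1 ^ 4 *
      (2 * ((z.2 + r ^ 4) / r ^ 4) * (U z * tderiv n U z) + U z ^ 2 / r ^ 4) := by
    rw [heatBall_fubini p r (by fun_prop)]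
    refine integral_nonneg fun x => ?_
    simp only [Pi.zero_apply]
    rw [integral_const_mul]
    exact mul_nonneg (by positivity)
      (time_nonneg hb (tderiv_hasDerivAt hU x) (by fun_prop))
  have hbd : ∫ z in heatBall n p r, η z.1 ^ 4 *
      (2 * ((z.2 + r ^ 4) / r ^ 4) * (U z * tderiv n U z) + U z ^ 2 / r ^ 4) ≤
      ∫ z in heatBall n p r, (2 * ((z.2 + r ^ 4) / r ^ 4) * (-κ * (η z.1 ^ 4 * G z) + H z)
        + η z.1 ^ 4 * (U z ^ 2 / r ^ 4)) := by
    obtain ⟨i1, e1⟩ := heatBall_fubini_symm p r (f := fun z => η z.1 ^ 4 *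
      (2 * ((z.2 + r ^ 4) / r ^ 4) * (U z * tderiv n U z) + U z ^ 2 / r ^ 4)) (by fun_prop)
    obtain ⟨i2, e2⟩ := heatBall_fubini_symm p r
      (f := fun z => 2 * ((z.2 + r ^ 4) / r ^ 4) * (-κ * (η z.1 ^ 4 * G z) + H z)
        + η z.1 ^ 4 * (U z ^ 2 / r ^ 4)) (by fun_prop)
    rw [e1, e2]
    refine setIntegral_mono_on i1 i2 measurableSet_Icc fun t ht => ?_
    have h0 : 0 ≤ 2 * ((t + r ^ 4) / r ^ 4) := by
      have : 0 ≤ t + r ^ 4 := by linarith [ht.1]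
      positivity
    have s1 : ∫ x in ball p r, η x ^ 4 *
      (2 * ((t + r ^ 4) / r ^ 4) * (U (x, t) * tderiv n U (x, t)) + U (x, t) ^ 2 / r ^ 4)
      = 2 * ((t + r ^ 4) / r ^ 4) * (∫ x in ball p r, η x ^ 4 * (U (x, t) * tderiv n U (x, t)))
        + ∫ x in ball p r, η x ^ 4 * (U (x, t) ^ 2 / r ^ 4) := by
      rw [← integral_const_mul, ← integral_add (ball_integrable _ _ (by fun_prop))
        (ball_integrable _ _ (by fun_prop))]
      congr 1; funext x; ring
    have s2 : ∫ x in ball p r, (2 * ((t + r ^ 4) / r ^ 4) * (-κ * (η x ^ 4 * G (x, t)) + H (x, t))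
        + η x ^ 4 * (U (x, t) ^ 2 / r ^ 4))
      = 2 * ((t + r ^ 4) / r ^ 4) * (∫ x in ball p r, (-κ * (η x ^ 4 * G (x, t)) + H (x, t)))
        + ∫ x in ball p r, η x ^ 4 * (U (x, t) ^ 2 / r ^ 4) := by
      rw [← integral_const_mul, ← integral_add (ball_integrable _ _ (by fun_prop))
        (ball_integrable _ _ (by fun_prop))]
    simp only []
    rw [s1, s2]
    have := mul_le_mul_of_nonneg_left (hyp t ht) h0
    linarith
  have hcd : ∫ z in heatBall n p r, (2 * ((z.2 + r ^ 4) / r ^ 4) * (-κ * (η z.1 ^ 4 * G z) + H z)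
        + η z.1 ^ 4 * (U z ^ 2 / r ^ 4)) ≤
      ∫ z in heatBall n p r, ((2 * H z + U z ^ 2 / r ^ 4)
        - 2 * κ * ((z.2 + r ^ 4) / r ^ 4) * (η z.1 ^ 4 * G z)) := by
    refine setIntegral_mono_on (heatBall_integrable _ _ (by fun_prop))
      (heatBall_integrable _ _ (by fun_prop)) (mQ r) fun z hz => ?_
    have hψ : (z.2 + r ^ 4) / r ^ 4 ≤ 1 := by
      rw [div_le_one hb]; linarith [hz.2.2]
    have hη4 : η z.1 ^ 4 ≤ 1 := pow_le_one₀ (C.nonneg _) (C.le_one _)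
    have h1 := mul_le_mul_of_nonneg_right hψ (hH0 z)
    have h2 : η z.1 ^ 4 * (U z ^ 2 / r ^ 4) ≤ 1 * (U z ^ 2 / r ^ 4) :=
      mul_le_mul_of_nonneg_right hη4 (by positivity)
    linarith
  rw [integral_sub (heatBall_integrable _ _ (by fun_prop))
      (heatBall_integrable _ _ (by fun_prop))] at hcd
  have hsub : heatBall n p (θ * r) ⊆ heatBall n p r := by
    refine prod_mono (ball_subset_ball ?_) (Icc_subset_Icc_left ?_)
    · nlinarith [hθ.2]
    · rw [mul_pow]; nlinarith
  have hlow : (1 - θ ^ 4) * (2 * κ) * ∫ z in heatBall n p (θ * r), G z ≤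
      ∫ z in heatBall n p (θ * r), 2 * κ * ((z.2 + r ^ 4) / r ^ 4) * (η z.1 ^ 4 * G z) := by
    rw [← integral_const_mul]
    refine setIntegral_mono_on (heatBall_integrable _ _ (by fun_prop))
      (heatBall_integrable _ _ (by fun_prop)) (mQ _) fun z hz => ?_
    have hψ : 1 - θ ^ 4 ≤ (z.2 + r ^ 4) / r ^ 4 := by
      rw [le_div_iff₀ hb]
      have := hz.2.1
      rw [mul_pow] at this
      linarith
    rw [C.one z.1 hz.1]
    have := mul_le_mul_of_nonneg_right hψ (mul_nonneg (by positivity : 0 ≤ 2 * κ) (hG0 z))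
    linarith
  have hmono : ∫ z in heatBall n p (θ * r), 2 * κ * ((z.2 + r ^ 4) / r ^ 4) * (η z.1 ^ 4 * G z) ≤
      ∫ z in heatBall n p r, 2 * κ * ((z.2 + r ^ 4) / r ^ 4) * (η z.1 ^ 4 * G z) := by
    refine setIntegral_mono_set (heatBall_integrable _ _ (by fun_prop)) ?_
      (Filter.Eventually.of_forall hsub)
    refine (ae_restrict_iff' (mQ r)).2 (Filter.Eventually.of_forall fun z hz => ?_)
    have : 0 ≤ z.2 + r ^ 4 := by linarith [hz.2.1]
    have := hG0 z
    simp only [Pi.zero_apply]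
    positivity
  linarith

/-! ### Cutoff functions -/

lemma pdE_scale {n : ℕ} (i : Fin n) {f : EuclideanSpace ℝ (Fin n) → ℝ}
    (hf : ContDiff ℝ (⊤ : ℕ∞) f) (p : EuclideanSpace ℝ (Fin n)) (a c : ℝ) :
    pdE n i (fun x => c * f (a • (x - p))) = fun x => (c * a) * pdE n i f (a • (x - p)) := by
  funext x
  have h1 : HasFDerivAt f (fderiv ℝ f (a • (x - p))) (a • (x - p)) :=
    (smooth_diff hf _).hasFDerivAt
  have h2 : HasFDerivAt (fun x : EuclideanSpace ℝ (Fin n) => a • (x - p))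
      (a • ContinuousLinearMap.id ℝ _) x := ((hasFDerivAt_id x).sub_const p).const_smul a
  have h3 := ((h1.comp x h2).const_mul c).fderiv
  unfold pdE
  change fderiv ℝ (fun x => c * (f ∘ fun x => a • (x - p)) x) x _ = _
  rw [h3]
  simp
  ring

lemma exists_cutoff (n : ℕ) {θ : ℝ} (hθ : θ ∈ Ioo (0 : ℝ) 1) :
    ∃ K : ℝ, 0 < K ∧ ∀ (p : EuclideanSpace ℝ (Fin n)) (r : ℝ), 0 < r →
      ∃ η, Cutoff n p r θ (K / r) η := by
  let b : ContDiffBump (0 : EuclideanSpace ℝ (Fin n)) := ⟨θ, 1, hθ.1, hθ.2⟩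
  have hb : ContDiff ℝ (⊤ : ℕ∞) b := b.contDiff
  have hc : HasCompactSupport b := b.hasCompactSupport
  have c1 : Continuous fun x => ∑ i, pdE n i b x ^ 2 :=
    continuous_finsetSum _ fun i _ => ((pdE_smooth i hb).continuous.pow 2)
  have c2 : Continuous (lapE n b) := (lapE_smooth hb).continuous
  have z1 : ∀ i, ∀ x ∉ closedBall (0 : EuclideanSpace ℝ (Fin n)) 1, pdE n i b x = 0 := by
    intro i x hx
    have : x ∉ tsupport b := by rw [b.tsupport_eq]; exact hx
    unfold pdE
    rw [fderiv_of_notMem_tsupport (𝕜 := ℝ) this]; simp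
  obtain ⟨K1, hK1⟩ := (isCompact_closedBall (0 : EuclideanSpace ℝ (Fin n)) 1).exists_bound_of_continuousOn
    c1.continuousOn
  obtain ⟨K2, hK2⟩ := (isCompact_closedBall (0 : EuclideanSpace ℝ (Fin n)) 1).exists_bound_of_continuousOn
    c2.continuousOn
  have z2 : ∀ x ∉ closedBall (0 : EuclideanSpace ℝ (Fin n)) 1, lapE n b x = 0 := by
    intro x hx
    rw [lapE_eq]
    refine Finset.sum_eq_zero fun i _ => ?_
    have hx' : x ∉ tsupport b := by rw [b.tsupport_eq]; exact hx
    have : x ∉ tsupport (pdE n i b) := fun h => hx' (tsupport_fderiv_apply_subset ℝ _ h)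
    unfold pdE at this ⊢
    rw [fderiv_of_notMem_tsupport (𝕜 := ℝ) this]; simp
  set K := 1 + |K1| + |K2| with hK
  have K1' : 1 ≤ K := by rw [hK]; linarith [abs_nonneg K1, abs_nonneg K2]
  have KK : K ≤ K ^ 2 := by nlinarith
  have B1 : ∀ x, ∑ i, pdE n i b x ^ 2 ≤ K ^ 2 := by
    intro x
    by_cases hx : x ∈ closedBall (0 : EuclideanSpace ℝ (Fin n)) 1
    · have := (le_abs_self _).trans (hK1 x hx)
      linarith [le_abs_self K1, abs_nonneg K2]
    · simp [z1 _ x hx]; positivity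
  have B2 : ∀ x, |lapE n b x| ≤ K ^ 2 := by
    intro x
    by_cases hx : x ∈ closedBall (0 : EuclideanSpace ℝ (Fin n)) 1
    · have := hK2 x hx
      rw [Real.norm_eq_abs] at this
      linarith [le_abs_self K2, abs_nonneg K1]
    · simp [z2 x hx]; positivity
  refine ⟨K, by linarith, fun p r hr => ⟨fun x => b (r⁻¹ • (x - p)), ?_⟩⟩
  have hnorm : ∀ x, dist (r⁻¹ • (x - p)) 0 = dist x p / r := by
    intro x
    rw [dist_zero_right, norm_smul, dist_eq_norm, Real.norm_eq_abs, abs_of_pos (inv_pos.2 hr)]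
    field_simp
  have hz : ∀ x, x ∉ ball p r → b (r⁻¹ • (x - p)) = 0 := by
    intro x hx
    apply b.zero_of_le_dist
    rw [hnorm]
    change 1 ≤ _
    rw [le_div_iff₀ hr, one_mul]
    simpa using hx
  have d1 : ∀ i, pdE n i (fun x => b (r⁻¹ • (x - p)))
      = fun x => r⁻¹ * pdE n i b (r⁻¹ • (x - p)) := by
    intro i
    have := pdE_scale i hb p r⁻¹ 1
    simpa using this
  have d2 : ∀ i, pdE n i (pdE n i (fun x => b (r⁻¹ • (x - p))))
      = fun x => (r⁻¹ * r⁻¹) * pdE n i (pdE n i b) (r⁻¹ • (x - p)) := by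
    intro i
    rw [d1, pdE_scale i (pdE_smooth i hb)]
  refine ⟨?_, ?_, fun x => b.nonneg, fun x => b.le_one, hz, ?_, ?_, ?_⟩
  · exact hb.comp ((contDiff_id.sub contDiff_const).const_smul r⁻¹)
  · refine HasCompactSupport.intro (isCompact_closedBall p r) fun x hx => hz x fun h => hx ?_
    exact ball_subset_closedBall h
  · intro x hx
    apply b.one_of_mem_closedBall
    rw [mem_closedBall, hnorm]
    change _ ≤ θ
    rw [div_le_iff₀ hr]
    exact (mem_ball.1 hx).le
  · intro x
    simp only [d1, mul_pow, ← Finset.mul_sum]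
    rw [div_pow, inv_pow, div_eq_inv_mul]
    exact mul_le_mul_of_nonneg_left (B1 _) (by positivity)
  · intro x
    rw [lapE_eq]
    simp only [d2, ← Finset.mul_sum]
    rw [← lapE_eq, abs_mul, div_pow, div_eq_inv_mul]
    have : |r⁻¹ * r⁻¹| = (r ^ 2)⁻¹ := by
      rw [abs_of_pos (by positivity)]; rw [sq, mul_inv]
    rw [this]
    exact mul_le_mul_of_nonneg_left (B2 _) (by positivity)

/-! ### The two steps -/

lemma step1 (n : ℕ) {θ : ℝ} (hθ : θ ∈ Ioo (0 : ℝ) 1) :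
    ∃ c : ℝ, 0 < c ∧ ∀ (p : EuclideanSpace ℝ (Fin n)) (r : ℝ), 0 < r →
      ∀ u : EuclideanSpace ℝ (Fin n) × ℝ → ℝ, ContDiff ℝ (⊤ : ℕ∞) u → BicaloricOn n u r →
      r ^ 4 * (∫ z in heatBall n p (θ * r), (slap n u z) ^ 2) ≤
      c * ((∫ z in heatBall n p r, (u z) ^ 2) +
          r ^ 2 * ∫ z in heatBall n p r, ‖sgrad n u z‖ ^ 2) := by
  obtain ⟨K, hK, hcut⟩ := exists_cutoff n hθ
  have hθ4 : 0 < 1 - θ ^ 4 := by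
    have := pow_lt_one₀ hθ.1.le hθ.2 (n := 4) (by norm_num)
    linarith
  refine ⟨(512 * K ^ 4 + 512 * K ^ 2 + 1) / (1 - θ ^ 4), by positivity, ?_⟩
  intro p r hr u hu hbi
  obtain ⟨η, C⟩ := hcut p r hr
  have hgr : ∀ z : EuclideanSpace ℝ (Fin n) × ℝ, ‖sgrad n u z‖ ^ 2 = ∑ i, spd n i u z ^ 2 := by
    intro z; rw [sgrad_norm_sq]; simp only [pdE_slice _ hu]
  have c1 : ∀ i, Continuous (spd n i u) := fun i => (spd_smooth i hu).continuous
  have c2 := hu.continuous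
  have c3 := (slap_smooth hu).continuous
  have E := energy (κ := 1 / 2) hr hθ (by norm_num) C (U := u) (G := fun z => slap n u z ^ 2)
    (H := fun z => 256 * ((K / r) ^ 2 * (∑ i, spd n i u z ^ 2) + (K / r) ^ 4 * u z ^ 2))
    hu (by fun_prop) (by fun_prop) (fun z => sq_nonneg _)
    (fun z => by
      have : 0 ≤ ∑ i, spd n i u z ^ 2 := Finset.sum_nonneg fun i _ => sq_nonneg _
      positivity)
    (fun t ht => by
      have h := slice1 C (slice_smooth hu t)
      simp only [pdE_slice _ hu] at h
      have e : ∀ x, tderiv n u (x, t) = - lapE n (lapE n fun y => u (y, t)) x := by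
        intro x
        have := hbi x t ht
        have e' : slap n (slap n u) (x, t) = lapE n (lapE n fun y => u (y, t)) x := rfl
        linarith
      simp only [e]
      exact h)
  have R : ∫ z in heatBall n p r, (2 * (256 * ((K / r) ^ 2 * (∑ i, spd n i u z ^ 2)
        + (K / r) ^ 4 * u z ^ 2)) + u z ^ 2 / r ^ 4)
      = 512 * (K / r) ^ 2 * (∫ z in heatBall n p r, ∑ i, spd n i u z ^ 2)
        + (512 * (K / r) ^ 4 + 1 / r ^ 4) * ∫ z in heatBall n p r, u z ^ 2 := by
    rw [← integral_const_mul, ← integral_const_mul,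
      ← integral_add (heatBall_integrable _ _ (by fun_prop))
        (heatBall_integrable _ _ (by fun_prop))]
    congr 1; funext z; ring
  rw [R] at E
  simp only [hgr]
  have hA : 0 ≤ ∫ z in heatBall n p r, u z ^ 2 := integral_nonneg fun z => sq_nonneg _
  have hB : 0 ≤ ∫ z in heatBall n p r, ∑ i, spd n i u z ^ 2 :=
    integral_nonneg fun z => Finset.sum_nonneg fun i _ => sq_nonneg _
  generalize (∫ z in heatBall n p r, u z ^ 2) = A at *
  generalize (∫ z in heatBall n p r, ∑ i, spd n i u z ^ 2) = B at *
  generalize (∫ z in heatBall n p (θ * r), slap n u z ^ 2) = W at *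
  rw [div_mul_eq_mul_div, le_div_iff₀ hθ4]
  have E2 := mul_le_mul_of_nonneg_left E (by positivity : 0 ≤ r ^ 4)
  have e3 : r ^ 4 * (512 * (K / r) ^ 2 * B + (512 * (K / r) ^ 4 + 1 / r ^ 4) * A)
      = 512 * K ^ 2 * (r ^ 2 * B) + (512 * K ^ 4 + 1) * A := by field_simp
  rw [e3] at E2
  have : 0 ≤ r ^ 2 * B := by positivity
  have k1 : 0 ≤ (512 * K ^ 4 + 1) * (r ^ 2 * B) := by positivity
  have k2 : 0 ≤ 512 * K ^ 2 * A := by positivity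
  linarith

lemma step2 (n : ℕ) {θ : ℝ} (hθ : θ ∈ Ioo (0 : ℝ) 1) :
    ∃ c : ℝ, 0 < c ∧ ∀ (p : EuclideanSpace ℝ (Fin n)) (r : ℝ), 0 < r →
      ∀ u : EuclideanSpace ℝ (Fin n) × ℝ → ℝ, ContDiff ℝ (⊤ : ℕ∞) u → BicaloricOn n u r →
      r ^ 4 * (∫ z in heatBall n p (θ * r), (tderiv n u z) ^ 2) ≤
      c * (∫ z in heatBall n p r, (slap n u z) ^ 2) := by
  obtain ⟨K, hK, hcut⟩ := exists_cutoff n hθ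
  have hθ4 : 0 < 1 - θ ^ 4 := by
    have := pow_lt_one₀ hθ.1.le hθ.2 (n := 4) (by norm_num)
    linarith
  refine ⟨2 * (34000 * K ^ 4 + 1) / (1 - θ ^ 4), by positivity, ?_⟩
  intro p r hr u hu hbi
  obtain ⟨η, C⟩ := hcut p r hr
  have hw := slap_smooth hu
  have hg := tderiv_smooth hu
  have c2 := hg.continuous
  have c3 := hw.continuous
  have E := energy (κ := 1 / 4) hr hθ (by norm_num) C (U := slap n u)
    (G := fun z => tderiv n u z ^ 2)
    (H := fun z => 17000 * ((K / r) ^ 4 * slap n u z ^ 2))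
    hw (by fun_prop) (by fun_prop) (fun z => sq_nonneg _) (fun z => by positivity)
    (fun t ht => by
      have h := slice2 C (slice_smooth hw t) (slice_smooth hg t) (fun x => hbi x t ht)
      rw [tderiv_slap hu]
      exact h)
  have R : ∫ z in heatBall n p r, (2 * (17000 * ((K / r) ^ 4 * slap n u z ^ 2))
        + slap n u z ^ 2 / r ^ 4)
      = (34000 * (K / r) ^ 4 + 1 / r ^ 4) * ∫ z in heatBall n p r, slap n u z ^ 2 := by
    rw [← integral_const_mul]
    congr 1; funext z; ring
  rw [R] at E
  generalize (∫ z in heatBall n p r, slap n u z ^ 2) = A at *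
  generalize (∫ z in heatBall n p (θ * r), tderiv n u z ^ 2) = W at *
  rw [div_mul_eq_mul_div, le_div_iff₀ hθ4]
  have E2 := mul_le_mul_of_nonneg_left E (by positivity : 0 ≤ r ^ 4)
  have e3 : r ^ 4 * ((34000 * (K / r) ^ 4 + 1 / r ^ 4) * A)
      = (34000 * K ^ 4 + 1) * A := by field_simp
  rw [e3] at E2
  linarith

/-- **Time-derivative estimate for bicaloric functions** (Lemma 2.3, Euclidean case). -/
theorem time_derivative_estimate_bicaloric (n : ℕ) (hn : 1 ≤ n) (ε : ℝ)
    (hε : ε ∈ Set.Ioo (0 : ℝ) 1) :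
    ∃ c : ℝ, 0 < c ∧
      ∀ (p : EuclideanSpace ℝ (Fin n)) (r : ℝ), 0 < r →
      ∀ u : EuclideanSpace ℝ (Fin n) × ℝ → ℝ, ContDiff ℝ (⊤ : ℕ∞) u → BicaloricOn n u r →
      r ^ 8 * (∫ z in heatBall n p (ε * r), (tderiv n u z) ^ 2) ≤
      c * ((∫ z in heatBall n p r, (u z) ^ 2) +
          r ^ 2 * ∫ z in heatBall n p r, ‖sgrad n u z‖ ^ 2) := by
  have hs0 : 0 < Real.sqrt ε := Real.sqrt_pos.2 hε.1
  have hss : Real.sqrt ε * Real.sqrt ε = ε := Real.mul_self_sqrt hε.1.le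
  have hs1 : Real.sqrt ε < 1 := by nlinarith [hε.2]
  generalize Real.sqrt ε = θ at *
  obtain ⟨c1, hc1, h1⟩ := step1 n (θ := θ) ⟨hs0, hs1⟩
  obtain ⟨c2, hc2, h2⟩ := step2 n (θ := θ) ⟨hs0, hs1⟩
  refine ⟨c2 * c1 / θ ^ 4, by positivity, ?_⟩
  intro p r hr u hu hbi
  have hb : BicaloricOn n u (θ * r) := by
    intro x t ht
    refine hbi x t ⟨le_trans ?_ ht.1, ht.2⟩
    have : (θ * r) ^ 4 ≤ r ^ 4 := pow_le_pow_left₀ (by positivity) (by nlinarith) 4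
    linarith
  have a1 := h1 p r hr u hu hbi
  have a2 := h2 p (θ * r) (by positivity) u hu hb
  rw [← mul_assoc, hss] at a2
  generalize (∫ z in heatBall n p (ε * r), tderiv n u z ^ 2) = W at *
  generalize (∫ z in heatBall n p (θ * r), slap n u z ^ 2) = V at *
  generalize ((∫ z in heatBall n p r, u z ^ 2) +
    r ^ 2 * ∫ z in heatBall n p r, ‖sgrad n u z‖ ^ 2) = Z at *
  rw [div_mul_eq_mul_div, le_div_iff₀ (by positivity)]
  have b1 := mul_le_mul_of_nonneg_left a2 (by positivity : 0 ≤ r ^ 4)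
  have b2 := mul_le_mul_of_nonneg_left a1 hc2.le
  rw [mul_pow] at b1
  linarith
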